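/- Let a, b, c, d, u, v, w, x, y, z be ten distinct symbols and let F consist of the seven quadruples {a,b,c,d}, {a,b,u,v}, {c,d,u,v}, {a,c,w,x}, {b,d,w,x}, {a,d,y,z}, {b,c,y,z}. Then there is no injective map p from {a,b,c,d,u,v,w,x,y,z} to ℝ³ together with filled quadrilaterals Q_f ⊆ ℝ³ (for f ∈ F) with corner sets p(f), satisfying Q_f ∩ Q_{f'} = p(f ∩ f') for all distinct f, f' ∈ F, in which all seven quadrilaterals Q_f are convex sets; and there is also no such configuration in which none of the seven quadrilaterals Q_f is a convex set. -/

import Mathlib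

/-- `Q` is a filled quadrilateral with corner set `s`: `s` consists of four distinct
coplanar points which, for some labeling `a, b, c, d`, split `Q` into the two triangles
`conv {a, b, c}` and `conv {a, c, d}` meeting exactly in the segment `[a, c]`. -/
def IsFilledQuadrilateral (Q s : Set (EuclideanSpace ℝ (Fin 3))) : Prop :=
  ∃ a b c d : EuclideanSpace ℝ (Fin 3),
    s = {a, b, c, d} ∧
    a ≠ b ∧ a ≠ c ∧ a ≠ d ∧ b ≠ c ∧ b ≠ d ∧ c ≠ d ∧
    Coplanar ℝ ({a, b, c, d} : Set (EuclideanSpace ℝ (Fin 3))) ∧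
    AffineIndependent ℝ ![a, b, c] ∧ AffineIndependent ℝ ![a, c, d] ∧
    convexHull ℝ ({a, b, c} : Set (EuclideanSpace ℝ (Fin 3))) ∩
      convexHull ℝ ({a, c, d} : Set (EuclideanSpace ℝ (Fin 3))) = segment ℝ a c ∧
    Q = convexHull ℝ ({a, b, c} : Set (EuclideanSpace ℝ (Fin 3))) ∪
      convexHull ℝ ({a, c, d} : Set (EuclideanSpace ℝ (Fin 3)))

/-- The family `F` of seven quadruples of Lemma 4 of the paper:
`{a,b,c,d}, {a,b,u,v}, {c,d,u,v}, {a,c,w,x}, {b,d,w,x}, {a,d,y,z}, {b,c,y,z}`. -/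
def quadFamily {α : Type*} (a b c d u v w x y z : α) : Fin 7 → Set α :=
  ![{a, b, c, d}, {a, b, u, v}, {c, d, u, v}, {a, c, w, x}, {b, d, w, x},
    {a, d, y, z}, {b, c, y, z}]

/-- A filled quadrilateral misses the midpoint of at most one pair of its corners, namely of
its second diagonal. -/
theorem IsFilledQuadrilateral.midpoint_mem_or {Q s : Set (EuclideanSpace ℝ (Fin 3))}
    (h : IsFilledQuadrilateral Q s) {x y z w : EuclideanSpace ℝ (Fin 3)}
    (hx : x ∈ s) (hy : y ∈ s) (hz : z ∈ s) (hw : w ∈ s) (hxz : x ≠ z) (hxw : x ≠ w) :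
    midpoint ℝ x y ∈ Q ∨ midpoint ℝ z w ∈ Q := by
  obtain ⟨a, b, c, d, rfl, -, -, -, -, -, -, -, -, -, -, rfl⟩ := h
  have mem_hull {t : Set (EuclideanSpace ℝ (Fin 3))} {p q : EuclideanSpace ℝ (Fin 3)}
      (hp : p ∈ t) (hq : q ∈ t) : midpoint ℝ p q ∈ convexHull ℝ t :=
    (convex_convexHull ℝ t).midpoint_mem (subset_convexHull ℝ t hp) (subset_convexHull ℝ t hq)
  have key : ∀ p ∈ ({a, b, c, d} : Set (EuclideanSpace ℝ (Fin 3))),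
      ∀ q ∈ ({a, b, c, d} : Set (EuclideanSpace ℝ (Fin 3))),
      (p = b ∧ q = d) ∨ (p = d ∧ q = b) ∨
      midpoint ℝ p q ∈ convexHull ℝ ({a, b, c} : Set (EuclideanSpace ℝ (Fin 3))) ∪
        convexHull ℝ ({a, c, d} : Set (EuclideanSpace ℝ (Fin 3))) := by
    intro p hp q hq
    have split : (p = b ∧ q = d) ∨ (p = d ∧ q = b) ∨
        (p ∈ ({a, b, c} : Set (EuclideanSpace ℝ (Fin 3))) ∧
          q ∈ ({a, b, c} : Set (EuclideanSpace ℝ (Fin 3)))) ∨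
        (p ∈ ({a, c, d} : Set (EuclideanSpace ℝ (Fin 3))) ∧
          q ∈ ({a, c, d} : Set (EuclideanSpace ℝ (Fin 3)))) := by
      simp only [Set.mem_insert_iff, Set.mem_singleton_iff] at hp hq ⊢
      tauto
    rcases split with h | h | h | h
    · exact Or.inl h
    · exact Or.inr (Or.inl h)
    · exact Or.inr (Or.inr (Or.inl (mem_hull h.1 h.2)))
    · exact Or.inr (Or.inr (Or.inr (mem_hull h.1 h.2)))
  rcases key x hx y hy with ⟨h, -⟩ | ⟨h, -⟩ | h
  · rcases key z hz w hw with ⟨h', -⟩ | ⟨-, h'⟩ | h'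
    exacts [absurd (h.trans h'.symm) hxz, absurd (h.trans h'.symm) hxw, Or.inr h']
  · rcases key z hz w hw with ⟨-, h'⟩ | ⟨h', -⟩ | h'
    exacts [absurd (h.trans h'.symm) hxw, absurd (h.trans h'.symm) hxz, Or.inr h']
  · exact Or.inl h

/-- If two sets meet only in images of points of a pair, they cannot share the midpoint of the
images of that pair. -/
theorem midpoint_notMem_of_inter_eq_image {α E : Type*} [AddCommGroup E] [Module ℝ E]
    {p : α → E} {Q R : Set E} {f g : Set α} {x y : α} (hne : p x ≠ p y)
    (hsub : f ∩ g ⊆ {x, y}) (hQR : Q ∩ R = p '' (f ∩ g))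
    (hQ : midpoint ℝ (p x) (p y) ∈ Q) : midpoint ℝ (p x) (p y) ∉ R := by
  intro hR
  have hmem : midpoint ℝ (p x) (p y) ∈ p '' (f ∩ g) := hQR ▸ ⟨hQ, hR⟩
  obtain ⟨e, he, hpe⟩ := hmem
  rcases hsub he with rfl | rfl
  · exact hne ((midpoint_eq_left_iff ℝ).mp hpe.symm)
  · exact hne ((midpoint_eq_right_iff ℝ).mp hpe.symm)

/-- Two filled quadrilaterals on `a, b, u, v` and `c, d, u, v` cannot meet a set `P` containing
the midpoints of `a, b` and of `c, d` only in common corners. -/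
theorem midpoint_notMem_of_filled_pair {α : Type*} {a b c d u v : α}
    {p : α → EuclideanSpace ℝ (Fin 3)} {P Q R : Set (EuclideanSpace ℝ (Fin 3))}
    (hinj : Set.InjOn p {a, b, c, d, u, v})
    (hdist : List.Pairwise (· ≠ ·) [a, b, c, d, u, v])
    (hQ : IsFilledQuadrilateral Q (p '' {a, b, u, v}))
    (hR : IsFilledQuadrilateral R (p '' {c, d, u, v}))
    (hPQ : P ∩ Q = p '' ({a, b, c, d} ∩ {a, b, u, v}))
    (hPR : P ∩ R = p '' ({a, b, c, d} ∩ {c, d, u, v}))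
    (hQR : Q ∩ R = p '' ({a, b, u, v} ∩ {c, d, u, v}))
    (hab : midpoint ℝ (p a) (p b) ∈ P) : midpoint ℝ (p c) (p d) ∉ P := by
  intro hcd
  have ne {s t : α} (hs : s ∈ ({a, b, c, d, u, v} : Set α))
      (ht : t ∈ ({a, b, c, d, u, v} : Set α)) (hst : s ≠ t) : p s ≠ p t :=
    fun h => hst (hinj hs ht h)
  simp only [List.pairwise_cons, List.mem_cons, List.not_mem_nil, or_false, forall_eq_or_imp,
    forall_eq, IsEmpty.forall_iff, implies_true, List.Pairwise.nil, and_true] at hdist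
  obtain ⟨⟨nab, nac, nad, nau, nav⟩, ⟨nbc, nbd, nbu, nbv⟩, ⟨ncd, ncu, ncv⟩, ⟨ndu, ndv⟩, nuv⟩ :=
    hdist
  have huvQ : midpoint ℝ (p u) (p v) ∈ Q := by
    refine (hQ.midpoint_mem_or (x := p a) (y := p b) ?_ ?_ ?_ ?_ (ne ?_ ?_ nau)
      (ne ?_ ?_ nav)).resolve_left
      (midpoint_notMem_of_inter_eq_image (ne ?_ ?_ nab) ?_ hPQ hab)
    on_goal 11 =>
      rintro e ⟨he, he'⟩
      simp only [Set.mem_insert_iff, Set.mem_singleton_iff] at he he' ⊢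
      grind
    all_goals first | exact Set.mem_image_of_mem p (by simp) | simp
  have huvR : midpoint ℝ (p u) (p v) ∈ R := by
    refine (hR.midpoint_mem_or (x := p c) (y := p d) ?_ ?_ ?_ ?_ (ne ?_ ?_ ncu)
      (ne ?_ ?_ ncv)).resolve_left
      (midpoint_notMem_of_inter_eq_image (ne ?_ ?_ ncd) ?_ hPR hcd)
    on_goal 11 =>
      rintro e ⟨he, he'⟩
      simp only [Set.mem_insert_iff, Set.mem_singleton_iff] at he he' ⊢
      grind
    all_goals first | exact Set.mem_image_of_mem p (by simp) | simp
  refine midpoint_notMem_of_inter_eq_image (ne ?_ ?_ nuv) ?_ hQR huvQ huvR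
  on_goal 3 =>
    rintro e ⟨he, he'⟩
    simp only [Set.mem_insert_iff, Set.mem_singleton_iff] at he he' ⊢
    grind
  all_goals simp

/-- The seven quadruples have no drawing by filled quadrilaterals, convex or not. -/
theorem quadFamily_not_drawable {α : Type*} {a b c d u v w x y z : α}
    (hdist : List.Pairwise (· ≠ ·) [a, b, c, d, u, v, w, x, y, z])
    {p : α → EuclideanSpace ℝ (Fin 3)} {Q : Fin 7 → Set (EuclideanSpace ℝ (Fin 3))}
    (hinj : Set.InjOn p {a, b, c, d, u, v, w, x, y, z})
    (hQ : ∀ i, IsFilledQuadrilateral (Q i) (p '' quadFamily a b c d u v w x y z i))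
    (hinter : ∀ i j, i ≠ j → Q i ∩ Q j =
      p '' (quadFamily a b c d u v w x y z i ∩ quadFamily a b c d u v w x y z j)) : False := by
  simp only [List.pairwise_cons, List.mem_cons, List.not_mem_nil, or_false, forall_eq_or_imp,
    forall_eq, IsEmpty.forall_iff, implies_true, List.Pairwise.nil, and_true] at hdist
  have hcomm : ({a, b, c, d} : Set α) = {a, c, b, d} := by
    rw [Set.insert_comm b c]
  have h03 : Q 0 ∩ Q 3 = p '' ({a, c, b, d} ∩ {a, c, w, x}) := by
    rw [← hcomm]
    exact hinter 0 3 (by decide)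
  have h04 : Q 0 ∩ Q 4 = p '' ({a, c, b, d} ∩ {b, d, w, x}) := by
    rw [← hcomm]
    exact hinter 0 4 (by decide)
  have inj_uv : Set.InjOn p {a, b, c, d, u, v} :=
    hinj.mono fun _ => by simp only [Set.mem_insert_iff, Set.mem_singleton_iff]; grind
  have inj_wx : Set.InjOn p {a, c, b, d, w, x} :=
    hinj.mono fun _ => by simp only [Set.mem_insert_iff, Set.mem_singleton_iff]; grind
  have dist_uv : List.Pairwise (· ≠ ·) [a, b, c, d, u, v] := by
    simp only [List.pairwise_cons, List.mem_cons, List.not_mem_nil, or_false, forall_eq_or_imp,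
      forall_eq, IsEmpty.forall_iff, implies_true, List.Pairwise.nil, and_true]
    grind
  have dist_wx : List.Pairwise (· ≠ ·) [a, c, b, d, w, x] := by
    simp only [List.pairwise_cons, List.mem_cons, List.not_mem_nil, or_false, forall_eq_or_imp,
      forall_eq, IsEmpty.forall_iff, implies_true, List.Pairwise.nil, and_true]
    grind
  have huv := midpoint_notMem_of_filled_pair inj_uv dist_uv (hQ 1) (hQ 2)
    (hinter 0 1 (by decide)) (hinter 0 2 (by decide)) (hinter 1 2 (by decide))
  have hwx := midpoint_notMem_of_filled_pair inj_wx dist_wx (hQ 3) (hQ 4)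
    h03 h04 (hinter 3 4 (by decide))
  have ne {s t : α} (hs : s ∈ ({a, b, c, d} : Set α)) (ht : t ∈ ({a, b, c, d} : Set α))
      (hst : s ≠ t) : p s ≠ p t :=
    fun h => hst (hinj (by simp only [Set.mem_insert_iff, Set.mem_singleton_iff] at hs ⊢; grind)
      (by simp only [Set.mem_insert_iff, Set.mem_singleton_iff] at ht ⊢; grind) h)
  have mem {s : α} (hs : s ∈ ({a, b, c, d} : Set α)) : p s ∈ p '' ({a, b, c, d} : Set α) :=
    Set.mem_image_of_mem p hs
  have hP : IsFilledQuadrilateral (Q 0) (p '' {a, b, c, d}) := hQ 0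
  have hab_ac := hP.midpoint_mem_or (x := p b) (y := p a) (z := p a) (w := p c)
    (mem (by simp)) (mem (by simp)) (mem (by simp)) (mem (by simp))
    (ne (by simp) (by simp) (by grind)) (ne (by simp) (by simp) (by grind))
  have hab_bd := hP.midpoint_mem_or (x := p a) (y := p b) (z := p b) (w := p d)
    (mem (by simp)) (mem (by simp)) (mem (by simp)) (mem (by simp))
    (ne (by simp) (by simp) (by grind)) (ne (by simp) (by simp) (by grind))
  have hcd_ac := hP.midpoint_mem_or (x := p d) (y := p c) (z := p a) (w := p c)
    (mem (by simp)) (mem (by simp)) (mem (by simp)) (mem (by simp))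
    (ne (by simp) (by simp) (by grind)) (ne (by simp) (by simp) (by grind))
  have hcd_bd := hP.midpoint_mem_or (x := p c) (y := p d) (z := p b) (w := p d)
    (mem (by simp)) (mem (by simp)) (mem (by simp)) (mem (by simp))
    (ne (by simp) (by simp) (by grind)) (ne (by simp) (by simp) (by grind))
  rw [midpoint_comm] at hab_ac hcd_ac
  by_cases hab : midpoint ℝ (p a) (p b) ∈ Q 0
  · have hcd := huv hab
    exact hwx (hcd_ac.resolve_left hcd) (hcd_bd.resolve_left hcd)
  · exact hwx (hab_ac.resolve_left hab) (hab_bd.resolve_left hab)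

/-- **Lemma 4 of the paper.** Let `a, b, c, d, u, v, w, x, y, z` be ten
distinct symbols and `F` the family of seven quadruples above.  Then there is no
non-crossing drawing of `F` by filled quadrilaterals in ℝ³ in which all seven
quadrilaterals are convex, and none in which all seven are non-convex. -/
theorem no_drawing_of_quad_family {α : Type*} (a b c d u v w x y z : α)
    (hdist : List.Pairwise (· ≠ ·) [a, b, c, d, u, v, w, x, y, z]) :
    (¬ ∃ (p : α → EuclideanSpace ℝ (Fin 3))
        (Q : Fin 7 → Set (EuclideanSpace ℝ (Fin 3))),
      Set.InjOn p {a, b, c, d, u, v, w, x, y, z} ∧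
      (∀ i, IsFilledQuadrilateral (Q i) (p '' quadFamily a b c d u v w x y z i)) ∧
      (∀ i j, i ≠ j → Q i ∩ Q j =
        p '' (quadFamily a b c d u v w x y z i ∩ quadFamily a b c d u v w x y z j)) ∧
      (∀ i, Convex ℝ (Q i))) ∧
    (¬ ∃ (p : α → EuclideanSpace ℝ (Fin 3))
        (Q : Fin 7 → Set (EuclideanSpace ℝ (Fin 3))),
      Set.InjOn p {a, b, c, d, u, v, w, x, y, z} ∧
      (∀ i, IsFilledQuadrilateral (Q i) (p '' quadFamily a b c d u v w x y z i)) ∧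
      (∀ i j, i ≠ j → Q i ∩ Q j =
        p '' (quadFamily a b c d u v w x y z i ∩ quadFamily a b c d u v w x y z j)) ∧
      (∀ i, ¬ Convex ℝ (Q i))) := by
  exact ⟨fun ⟨_, _, hinj, hQ, hinter, _⟩ => quadFamily_not_drawable hdist hinj hQ hinter,
    fun ⟨_, _, hinj, hQ, hinter, _⟩ => quadFamily_not_drawable hdist hinj hQ hinter⟩
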